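/- For all probability distributions A and B on {0,1}^n with B symmetric, the following two inequalities hold: dTV(A,B) ≤ dTV(A, A_sym) + dTV(|A|, |B|), and 3·dTV(A,B) ≥ dTV(A, A_sym) + dTV(|A|, |B|). -/

import Mathlib

open Finset

noncomputable section

/-- Hamming weight of a Boolean string. -/
def hw {n : ℕ} (x : Fin n → Bool) : ℕ := (Finset.univ.filter fun i => x i = true).card

/-- Uniform distribution on a finite set `C` (zero if `C` is empty). -/
def unifOn {α : Type} [Fintype α] [DecidableEq α] (C : Finset α) : α → ℝ :=
  fun x => if x ∈ C then (C.card : ℝ)⁻¹ else 0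

/-- Total variation distance between two (mass functions of) distributions. -/
def tvd {α : Type} [Fintype α] (A B : α → ℝ) : ℝ := (∑ x, |A x - B x|) / 2

/-- Pushforward of a distribution along `f`. -/
def pushf {α β : Type} [Fintype α] [DecidableEq β] (f : α → β) (A : α → ℝ) : β → ℝ :=
  fun y => ∑ x ∈ Finset.univ.filter (fun x => f x = y), A x

/-- `f` is `d`-local: each output coordinate depends on at most `d` input coordinates. -/
def IsLocal {m n : ℕ} (d : ℕ) (f : (Fin m → Bool) → (Fin n → Bool)) : Prop :=
  ∀ i : Fin n, ∃ T : Finset (Fin m), T.card ≤ d ∧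
    ∀ x y : Fin m → Bool, (∀ j ∈ T, x j = y j) → f x i = f y i

/-- `D_Ψ`: uniform distribution on strings whose Hamming weight lies in `Ψ`. -/
def DPsi (n : ℕ) (Ψ : Finset ℕ) : (Fin n → Bool) → ℝ :=
  unifOn (Finset.univ.filter fun x => hw x ∈ Ψ)

/-- The weight distribution of `A`: probability that the Hamming weight equals `k`. -/
def wd {n : ℕ} (A : (Fin n → Bool) → ℝ) (k : ℕ) : ℝ :=
  ∑ x ∈ Finset.univ.filter (fun x => hw x = k), A x

/-- Total variation distance between the weight distributions of `A` and `B`. -/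
def tvW {n : ℕ} (A B : (Fin n → Bool) → ℝ) : ℝ :=
  (∑ k ∈ Finset.range (n + 1), |wd A k - wd B k|) / 2

/-- Symmetrization of the distribution `A`. -/
def symA {n : ℕ} (A : (Fin n → Bool) → ℝ) : (Fin n → Bool) → ℝ :=
  fun x => wd A (hw x) / (n.choose (hw x))

lemma hw_le {n : ℕ} (x : Fin n → Bool) : hw x ≤ n :=
  (Finset.card_filter_le _ _).trans (by simp)

lemma card_hw_eq (n k : ℕ) :
    (Finset.univ.filter fun x : Fin n → Bool => hw x = k).card = n.choose k := by
  have h : (Finset.powersetCard k (Finset.univ : Finset (Fin n))).card = n.choose k := by simp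
  rw [← h]
  refine Finset.card_bij' (fun x _ => Finset.univ.filter fun i => x i = true)
    (fun s _ i => decide (i ∈ s)) ?_ ?_ ?_ ?_
  · intro x hx
    exact Finset.mem_powersetCard.2 ⟨Finset.subset_univ _, (Finset.mem_filter.1 hx).2⟩
  · intro s hs
    refine Finset.mem_filter.2 ⟨Finset.mem_univ _, ?_⟩
    simpa [hw] using hs
  · intro x _
    funext i
    simp
  · intro s _
    ext i
    simp

lemma sum_eq_sum_range_hw {n : ℕ} (f : (Fin n → Bool) → ℝ) :
    ∑ x, f x = ∑ k ∈ Finset.range (n + 1), ∑ x ∈ Finset.univ.filter (fun x => hw x = k), f x :=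
  (Finset.sum_fiberwise_of_maps_to
    (fun x _ => Finset.mem_range.2 (Nat.lt_succ_of_le (hw_le x))) f).symm

lemma tvd_triangle {α : Type} [Fintype α] (A B C : α → ℝ) : tvd A C ≤ tvd A B + tvd B C := by
  unfold tvd
  rw [← add_div, ← Finset.sum_add_distrib]
  gcongr
  exact abs_sub_le _ _ _

lemma tvd_comm {α : Type} [Fintype α] (A B : α → ℝ) : tvd A B = tvd B A := by
  simp only [tvd, abs_sub_comm]

/-- Passing to the weight distributions does not increase the total variation distance. -/
lemma tvW_le_tvd {n : ℕ} (A B : (Fin n → Bool) → ℝ) : tvW A B ≤ tvd A B := by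
  unfold tvW tvd
  rw [sum_eq_sum_range_hw]
  gcongr with k
  unfold wd
  rw [← Finset.sum_sub_distrib]
  exact Finset.abs_sum_le_sum_abs _ _

lemma wd_of_symmetric {n : ℕ} {B : (Fin n → Bool) → ℝ}
    (hB : ∀ x y, hw x = hw y → B x = B y) (x : Fin n → Bool) :
    wd B (hw x) = n.choose (hw x) * B x := by
  unfold wd
  rw [Finset.sum_congr rfl fun y hy => hB y x (Finset.mem_filter.1 hy).2,
    Finset.sum_const, card_hw_eq, nsmul_eq_mul]

/-- For symmetric `B`, the distance from `symA A` to `B` is that of the weight distributions. -/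
lemma tvd_symA_of_symmetric {n : ℕ} (A : (Fin n → Bool) → ℝ) {B : (Fin n → Bool) → ℝ}
    (hB : ∀ x y, hw x = hw y → B x = B y) : tvd (symA A) B = tvW A B := by
  unfold tvW tvd
  rw [sum_eq_sum_range_hw]
  congr 1
  refine Finset.sum_congr rfl fun k hk => ?_
  have hpos : (0 : ℝ) < n.choose k :=
    Nat.cast_pos.2 (Nat.choose_pos (Nat.lt_succ_iff.1 (Finset.mem_range.1 hk)))
  have h : ∀ x ∈ Finset.univ.filter (fun x : Fin n → Bool => hw x = k),
      |symA A x - B x| = |wd A k - wd B k| / n.choose k := by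
    intro x hx
    obtain rfl := (Finset.mem_filter.1 hx).2
    rw [wd_of_symmetric hB, symA, ← abs_of_pos hpos, ← abs_div, abs_of_pos hpos, sub_div,
      mul_div_cancel_left₀ _ hpos.ne']
  rw [Finset.sum_congr rfl h, Finset.sum_const, card_hw_eq, nsmul_eq_mul,
    mul_div_cancel₀ _ hpos.ne']

/-- For `A` arbitrary and `B` symmetric,
`dTV(A,B) ≤ dTV(A, A_sym) + dTV(|A|,|B|)` and `3·dTV(A,B) ≥ dTV(A, A_sym) + dTV(|A|,|B|)`. -/
theorem stmt1 {n : ℕ} (A B : (Fin n → Bool) → ℝ)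
    (hA0 : ∀ x, 0 ≤ A x) (hA1 : ∑ x, A x = 1)
    (hB0 : ∀ x, 0 ≤ B x) (hB1 : ∑ x, B x = 1)
    (hBsym : ∀ x y, hw x = hw y → B x = B y) :
    tvd A B ≤ tvd A (symA A) + tvW A B ∧
    tvd A (symA A) + tvW A B ≤ 3 * tvd A B := by
  have hs := tvd_symA_of_symmetric A hBsym
  have hle := tvW_le_tvd A B
  have h₁ := tvd_triangle A (symA A) B
  have h₂ := tvd_triangle A B (symA A)
  rw [tvd_comm B] at h₂
  constructor <;> linarith
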